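/- Let m be a positive integer, k ≥ 0 an integer, and T_m ⊆ ℝ³ the Reeve tetrahedron. Then the k-fold iterated pyramid Pyr^k(T_m) ⊆ ℝ^{k+3} is a full-dimensional integral polytope, and for every positive integer t the number of points of ℤ^{k+3} contained in t·Pyr^k(T_m) equals binom(t+k+3, k+3) + (m−1)·binom(t+k+1, k+3). -/

import Mathlib

open scoped Pointwise BigOperators

/-- `P` is an integral polytope: the convex hull of finitely many points
with integer coordinates. -/
def IsIntegralPolytope {N : ℕ} (P : Set (Fin N → ℝ)) : Prop :=
  ∃ V : Finset (Fin N → ℝ),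
    (∀ v ∈ V, ∀ i, ∃ z : ℤ, v i = (z : ℝ)) ∧
    P = convexHull ℝ (V : Set (Fin N → ℝ))

/-- `latticeCount P t = i(P,t)`: the number of points of `ℤ^N` in the dilate `t • P`. -/
noncomputable def latticeCount {N : ℕ} (P : Set (Fin N → ℝ)) (t : ℕ) : ℕ :=
  Set.ncard {x : Fin N → ℝ | x ∈ (t : ℝ) • P ∧ ∀ i, ∃ z : ℤ, x i = (z : ℝ)}

/-- The Reeve tetrahedron `T_m ⊆ ℝ³`. -/
def reeve (m : ℕ) : Set (Fin 3 → ℝ) :=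
  convexHull ℝ {![0, 0, 0], ![1, 0, 0], ![0, 1, 0], ![1, 1, (m : ℝ)]}

/-- The pyramid over a polytope `P ⊆ ℝⁿ`: the convex hull of `P × {0}` together
with the apex `(0,…,0,1)`. -/
def pyr {n : ℕ} (P : Set (Fin n → ℝ)) : Set (Fin (n + 1) → ℝ) :=
  convexHull ℝ ((fun x => Fin.snoc x (0 : ℝ)) '' P ∪ {Fin.snoc (0 : Fin n → ℝ) 1})

/-- The `k`-fold iterated pyramid, `Pyr^k(P)`. -/
def pyrIter {n : ℕ} : (k : ℕ) → Set (Fin n → ℝ) → Set (Fin (n + k) → ℝ)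
  | 0, P => P
  | k + 1, P => pyr (pyrIter k P)

/-- The points of `ℤ^N` in `t • P`. -/
def latticePoints {N : ℕ} (P : Set (Fin N → ℝ)) (t : ℕ) : Set (Fin N → ℝ) :=
  {x | x ∈ (t : ℝ) • P ∧ ∀ i, ∃ z : ℤ, x i = (z : ℝ)}

lemma latticeCount_eq_ncard_latticePoints {N : ℕ} (P : Set (Fin N → ℝ)) (t : ℕ) :
    latticeCount P t = (latticePoints P t).ncard := rfl

lemma latticePoints_zero {N : ℕ} {P : Set (Fin N → ℝ)} (hP : P.Nonempty) :
    latticePoints P 0 = {0} := by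
  ext x
  simp only [latticePoints, Nat.cast_zero, Set.zero_smul_set hP, Set.mem_zero, Set.mem_ofPred_eq,
    Set.mem_singleton_iff, and_iff_left_iff_imp]
  rintro rfl i
  exact ⟨0, by simp⟩

/-- The embedding `ℝⁿ → ℝⁿ⁺¹` as the hyperplane where the last coordinate vanishes. -/
def snocZero (n : ℕ) : (Fin n → ℝ) →ₗ[ℝ] (Fin (n + 1) → ℝ) where
  toFun x := Fin.snoc x (0 : ℝ)
  map_add' x y := by
    ext i
    induction i using Fin.lastCases <;> simp
  map_smul' c x := by
    ext i
    induction i using Fin.lastCases <;> simp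

lemma snocZero_apply {n : ℕ} (x : Fin n → ℝ) : snocZero n x = Fin.snoc x (0 : ℝ) := rfl

lemma snocZero_injective (n : ℕ) : Function.Injective (snocZero n) := by
  intro x y h
  ext i
  simpa [snocZero_apply] using congrFun h i.castSucc

lemma pyr_eq {n : ℕ} (P : Set (Fin n → ℝ)) :
    pyr P = convexHull ℝ (snocZero n '' P ∪ {Fin.snoc (0 : Fin n → ℝ) 1}) := rfl

lemma pyr_nonempty {n : ℕ} (P : Set (Fin n → ℝ)) : (pyr P).Nonempty :=
  ⟨_, subset_convexHull ℝ _ (Or.inr rfl)⟩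

lemma IsIntegralPolytope.convex {N : ℕ} {P : Set (Fin N → ℝ)} (hP : IsIntegralPolytope P) :
    Convex ℝ P := by
  obtain ⟨V, -, rfl⟩ := hP
  exact convex_convexHull ℝ _

lemma IsIntegralPolytope.pyr {n : ℕ} {P : Set (Fin n → ℝ)} (hP : IsIntegralPolytope P) :
    IsIntegralPolytope (pyr P) := by
  classical
  obtain ⟨V, hV, rfl⟩ := hP
  refine ⟨V.image (snocZero n) ∪ {Fin.snoc (0 : Fin n → ℝ) 1}, ?_, ?_⟩
  · intro v hv i
    simp only [Finset.mem_union, Finset.mem_image, Finset.mem_singleton] at hv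
    rcases hv with ⟨w, hw, rfl⟩ | rfl
    · induction i using Fin.lastCases with
      | last => exact ⟨0, by simp [snocZero_apply]⟩
      | cast i => simpa [snocZero_apply] using hV w hw i
    · induction i using Fin.lastCases with
      | last => exact ⟨1, by simp⟩
      | cast i => exact ⟨0, by simp⟩
  · rw [pyr_eq, LinearMap.image_convexHull, convexHull_convexHull_union_left]
    simp

lemma affineSpan_pyr {n : ℕ} {P : Set (Fin n → ℝ)} (hP : affineSpan ℝ P = ⊤) :
    affineSpan ℝ (pyr P) = ⊤ := by
  rw [pyr_eq, affineSpan_convexHull, eq_top_iff]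
  set S := affineSpan ℝ (snocZero n '' P ∪ {Fin.snoc (0 : Fin n → ℝ) 1})
  have hbase (x : Fin n → ℝ) : snocZero n x ∈ S := by
    have hx : snocZero n x ∈ (affineSpan ℝ P).map (snocZero n).toAffineMap :=
      ⟨x, by simp [hP], rfl⟩
    rw [AffineSubspace.map_span] at hx
    exact affineSpan_mono ℝ Set.subset_union_left hx
  have hapex : (Fin.snoc (0 : Fin n → ℝ) 1 : Fin (n + 1) → ℝ) ∈ S :=
    subset_affineSpan ℝ _ (Or.inr rfl)
  intro v _
  convert S.smul_vsub_vadd_mem (v (Fin.last n)) hapex (hbase 0) (hbase (Fin.init v)) using 1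
  ext i
  induction i using Fin.lastCases <;> simp [snocZero_apply, Fin.init]

lemma mem_pyr_iff {n : ℕ} {P : Set (Fin n → ℝ)} (hP : Convex ℝ P) (hne : P.Nonempty)
    {v : Fin (n + 1) → ℝ} :
    v ∈ pyr P ↔ ∃ p ∈ P, ∃ s : ℝ, 0 ≤ s ∧ s ≤ 1 ∧ v = Fin.snoc ((1 - s) • p) s := by
  have hconv : Convex ℝ (snocZero n '' P) := hP.linear_image _
  rw [pyr_eq, Set.union_singleton, convexHull_insert (hne.image _), hconv.convexHull_eq]
  simp only [mem_convexJoin, Set.mem_singleton_iff, exists_eq_left, Set.exists_mem_image]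
  refine exists_congr fun p => and_congr_right fun _ => ?_
  have key (a b : ℝ) : a • (Fin.snoc (0 : Fin n → ℝ) 1 : Fin (n + 1) → ℝ) + b • snocZero n p =
      Fin.snoc (b • p) a := by
    ext i
    induction i using Fin.lastCases <;> simp [snocZero_apply]
  constructor
  · rintro ⟨a, b, ha, hb, hab, rfl⟩
    exact ⟨a, ha, by linarith, by rw [key, ← hab, add_sub_cancel_left]⟩
  · rintro ⟨s, hs, hs1, rfl⟩
    exact ⟨s, 1 - s, hs, by linarith, by ring, key _ _⟩

lemma mem_smul_pyr_iff {n : ℕ} {P : Set (Fin n → ℝ)} (hP : Convex ℝ P) (hne : P.Nonempty)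
    {t : ℝ} (ht : 0 ≤ t) {v : Fin (n + 1) → ℝ} :
    v ∈ t • pyr P ↔ ∃ p ∈ P, ∃ s : ℝ, 0 ≤ s ∧ s ≤ t ∧ v = Fin.snoc ((t - s) • p) s := by
  have key (s : ℝ) (p : Fin n → ℝ) :
      t • (Fin.snoc ((1 - s) • p) s : Fin (n + 1) → ℝ) = Fin.snoc ((t - t * s) • p) (t * s) := by
    ext i
    induction i using Fin.lastCases <;> simp
    ring
  simp only [Set.mem_smul_set, mem_pyr_iff hP hne]
  constructor
  · rintro ⟨_, ⟨p, hp, s, hs, hs1, rfl⟩, rfl⟩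
    exact ⟨p, hp, t * s, by positivity, mul_le_of_le_one_right ht hs1, key s p⟩
  · rintro ⟨p, hp, s, hs, hst, rfl⟩
    refine ⟨_, ⟨p, hp, s / t, by positivity, div_le_one_of_le₀ hst ht, rfl⟩, ?_⟩
    have hts : t * (s / t) = s := by
      rcases ht.eq_or_lt with rfl | ht'
      · simp [le_antisymm hst hs]
      · field_simp
    rw [key, hts]

/-- Slicing `(t + 1) • pyr P` by the last coordinate: either it vanishes, or lowering it by one
gives a lattice point of `t • pyr P`. -/
lemma latticePoints_pyr_succ {n : ℕ} {P : Set (Fin n → ℝ)} (hP : Convex ℝ P) (hne : P.Nonempty)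
    (t : ℕ) :
    latticePoints (pyr P) (t + 1) = snocZero n '' latticePoints P (t + 1) ∪
      (· + Fin.snoc (0 : Fin n → ℝ) 1) '' latticePoints (pyr P) t := by
  have key (s c : ℝ) (p : Fin n → ℝ) : (Fin.snoc (c • p) s : Fin (n + 1) → ℝ) +
      Fin.snoc (0 : Fin n → ℝ) 1 = Fin.snoc (c • p) (s + 1) := by
    ext i
    induction i using Fin.lastCases <;> simp
  have ht : (0 : ℝ) ≤ t := t.cast_nonneg
  ext v
  simp only [latticePoints, Set.mem_union, Set.mem_image, Set.mem_ofPred_eq,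
    mem_smul_pyr_iff hP hne ht, mem_smul_pyr_iff hP hne (t + 1).cast_nonneg]
  constructor
  · rintro ⟨⟨p, hp, s, hs, hst, rfl⟩, hint⟩
    obtain ⟨z, hz⟩ := hint (Fin.last n)
    simp only [Fin.snoc_last] at hz
    subst hz
    have hcoord (i : Fin n) := hint i.castSucc
    simp only [Fin.snoc_castSucc] at hcoord
    have hz0 : 0 ≤ z := by exact_mod_cast hs
    rcases hz0.eq_or_lt with rfl | hz1
    · refine Or.inl ⟨_, ⟨Set.smul_mem_smul_set hp, fun i => ?_⟩, ?_⟩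
      · simpa using hcoord i
      · simp [← snocZero_apply]
    · have hz1' : (1 : ℝ) ≤ z := by exact_mod_cast hz1
      push_cast at hst hcoord
      refine Or.inr ⟨Fin.snoc ((t - ((z : ℝ) - 1)) • p) ((z : ℝ) - 1),
        ⟨⟨p, hp, (z : ℝ) - 1, by linarith, by linarith, rfl⟩, fun i => ?_⟩, ?_⟩
      · induction i using Fin.lastCases with
        | last => exact ⟨z - 1, by simp⟩
        | cast i =>
          convert hcoord i using 3
          simp only [Fin.snoc_castSucc, Pi.smul_apply, smul_eq_mul]
          ring
      · rw [key]
        congr 1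
        · push_cast
          congr 1
          ring
        · ring
  · rintro (⟨_, ⟨⟨p, hp, rfl⟩, hint⟩, rfl⟩ | ⟨_, ⟨⟨p, hp, s, hs, hst, rfl⟩, hint⟩, rfl⟩)
    · refine ⟨⟨p, hp, 0, le_rfl, by positivity, by simp [← snocZero_apply]⟩, fun i => ?_⟩
      induction i using Fin.lastCases with
      | last => exact ⟨0, by simp [snocZero_apply]⟩
      | cast i => simpa [snocZero_apply] using hint i
    · refine ⟨⟨p, hp, s + 1, by linarith, by push_cast; linarith, ?_⟩, fun i => ?_⟩
      · rw [key]
        congr 2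
        push_cast
        ring
      · obtain ⟨z, hz⟩ := hint i
        induction i using Fin.lastCases with
        | last => exact ⟨z + 1, by simpa using hz⟩
        | cast i => exact ⟨z, by simpa using hz⟩

lemma latticePoints_pyr_finite {n : ℕ} {P : Set (Fin n → ℝ)} (hP : Convex ℝ P) (hne : P.Nonempty)
    (hfin : ∀ t, (latticePoints P t).Finite) (t : ℕ) : (latticePoints (pyr P) t).Finite := by
  induction t with
  | zero => simp [latticePoints_zero (pyr_nonempty P)]
  | succ t ih =>
    rw [latticePoints_pyr_succ hP hne]
    exact ((hfin _).image _).union (ih.image _)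

lemma latticeCount_pyr_succ {n : ℕ} {P : Set (Fin n → ℝ)} (hP : Convex ℝ P) (hne : P.Nonempty)
    (hfin : ∀ t, (latticePoints P t).Finite) (t : ℕ) :
    latticeCount (pyr P) (t + 1) = latticeCount P (t + 1) + latticeCount (pyr P) t := by
  simp only [latticeCount_eq_ncard_latticePoints]
  rw [latticePoints_pyr_succ hP hne, Set.ncard_union_eq _ ((hfin _).image _)
    ((latticePoints_pyr_finite hP hne hfin t).image _),
    Set.ncard_image_of_injective _ (snocZero_injective n),
    Set.ncard_image_of_injective _ (add_left_injective _)]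
  rw [Set.disjoint_left]
  rintro _ ⟨x, -, rfl⟩ ⟨y, ⟨hy, -⟩, hxy⟩
  obtain ⟨p, -, s, hs, -, rfl⟩ := (mem_smul_pyr_iff hP hne t.cast_nonneg).1 hy
  have := congrFun hxy (Fin.last n)
  simp [snocZero_apply] at this
  linarith

lemma reeve_nonempty (m : ℕ) : (reeve m).Nonempty :=
  ⟨_, subset_convexHull ℝ _ (Or.inl rfl)⟩

lemma isIntegralPolytope_reeve (m : ℕ) : IsIntegralPolytope (reeve m) := by
  classical
  refine ⟨{![0, 0, 0], ![1, 0, 0], ![0, 1, 0], ![1, 1, (m : ℝ)]}, ?_, by simp [reeve]⟩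
  intro v hv i
  simp only [Finset.mem_insert, Finset.mem_singleton] at hv
  rcases hv with rfl | rfl | rfl | rfl <;> fin_cases i <;>
    first
    | exact ⟨0, Int.cast_zero.symm⟩
    | exact ⟨1, Int.cast_one.symm⟩
    | exact ⟨m, (Int.cast_natCast m).symm⟩

lemma affineSpan_reeve {m : ℕ} (hm : 0 < m) : affineSpan ℝ (reeve m) = ⊤ := by
  rw [reeve, affineSpan_convexHull, eq_top_iff]
  set S := affineSpan ℝ {![(0 : ℝ), 0, 0], ![1, 0, 0], ![0, 1, 0], ![1, 1, (m : ℝ)]}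
  have h0 : ![(0 : ℝ), 0, 0] ∈ S := subset_affineSpan ℝ _ (by simp)
  have h1 : ![(1 : ℝ), 0, 0] ∈ S := subset_affineSpan ℝ _ (by simp)
  have h2 : ![(0 : ℝ), 1, 0] ∈ S := subset_affineSpan ℝ _ (by simp)
  have h3 : ![(1 : ℝ), 1, (m : ℝ)] ∈ S := subset_affineSpan ℝ _ (by simp)
  intro v _
  have hm' : (m : ℝ) ≠ 0 := by positivity
  convert S.smul_vsub_vadd_mem (v 2 / m) h3 h0 (S.smul_vsub_vadd_mem (v 1 - v 2 / m) h2 h0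
    (S.smul_vsub_vadd_mem (v 0 - v 2 / m) h1 h0 h0)) using 1
  ext i
  fin_cases i <;> simp [hm']

lemma mem_reeve_iff {m : ℕ} (hm : 0 < m) {x : Fin 3 → ℝ} :
    x ∈ reeve m ↔ 0 ≤ x 2 ∧ x 2 ≤ m * x 0 ∧ x 2 ≤ m * x 1 ∧ m * (x 0 + x 1) ≤ m + x 2 := by
  have hm' : (0 : ℝ) < m := by exact_mod_cast hm
  constructor
  · intro hx
    refine convexHull_min (t := {x : Fin 3 → ℝ |
      0 ≤ x 2 ∧ x 2 ≤ m * x 0 ∧ x 2 ≤ m * x 1 ∧ m * (x 0 + x 1) ≤ m + x 2}) ?_ ?_ hx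
    · rintro v (rfl | rfl | rfl | rfl) <;> simp
      linarith
    · rintro x ⟨h1, h2, h3, h4⟩ y ⟨k1, k2, k3, k4⟩ a b ha hb hab
      simp only [Set.mem_ofPred_eq, Pi.add_apply, Pi.smul_apply, smul_eq_mul]
      obtain rfl : b = 1 - a := by linarith
      refine ⟨by positivity, ?_, ?_, ?_⟩
      · nlinarith [mul_le_mul_of_nonneg_left h2 ha, mul_le_mul_of_nonneg_left k2 hb]
      · nlinarith [mul_le_mul_of_nonneg_left h3 ha, mul_le_mul_of_nonneg_left k3 hb]
      · nlinarith [mul_le_mul_of_nonneg_left h4 ha, mul_le_mul_of_nonneg_left k4 hb]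
  · rintro ⟨h1, h2, h3, h4⟩
    have hd : x 2 = m * (x 2 / m) := by field_simp
    have hd0 : 0 ≤ x 2 / m := by positivity
    generalize x 2 / m = d at hd hd0
    rw [hd] at h2 h3 h4
    have h2' := le_of_mul_le_mul_left h2 hm'
    have h3' := le_of_mul_le_mul_left h3 hm'
    have h4' : x 0 + x 1 ≤ 1 + d := le_of_mul_le_mul_left (by linarith) hm'
    have hc := convex_convexHull ℝ
      {![(0 : ℝ), 0, 0], ![1, 0, 0], ![0, 1, 0], ![1, 1, (m : ℝ)]}
    have := hc.sum_mem (t := Finset.univ) (w := ![1 + d - x 0 - x 1, x 0 - d, x 1 - d, d])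
      (z := ![![0, 0, 0], ![1, 0, 0], ![0, 1, 0], ![1, 1, (m : ℝ)]])
      (by intro i _; fin_cases i <;> simp <;> linarith)
      (by simp [Fin.sum_univ_four]; ring)
      (by intro i _; apply subset_convexHull; fin_cases i <;> simp)
    rw [reeve]
    convert this using 1
    ext i
    fin_cases i <;> simp [Fin.sum_univ_four, hd, mul_comm]

lemma mem_smul_reeve_iff {m : ℕ} (hm : 0 < m) {t : ℝ} (ht : 0 < t) {x : Fin 3 → ℝ} :
    x ∈ t • reeve m ↔
      0 ≤ x 2 ∧ x 2 ≤ m * x 0 ∧ x 2 ≤ m * x 1 ∧ m * (x 0 + x 1) ≤ m * t + x 2 := by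
  rw [Set.mem_smul_set_iff_inv_smul_mem₀ ht.ne', mem_reeve_iff hm]
  simp only [Pi.smul_apply, smul_eq_mul]
  rw [← mul_le_mul_iff_right₀ ht, ← mul_le_mul_iff_right₀ (b := t⁻¹ * x 2) ht,
    ← mul_le_mul_iff_right₀ (b := t⁻¹ * x 2) (c := m * (t⁻¹ * x 1)) ht,
    ← mul_le_mul_iff_right₀ (b := m * (t⁻¹ * x 0 + t⁻¹ * x 1)) ht]
  field_simp
  simp

lemma card_antidiagonalTuple_succ (k n : ℕ) :
    (Finset.Nat.antidiagonalTuple (k + 1) n).card = (n + k).choose k := by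
  rw [← Finset.piAntidiag_univ_fin_eq_antidiagonalTuple, ← Finset.map_sym_eq_piAntidiag,
    Finset.card_map, Finset.sym_univ, Finset.card_univ, Sym.card_sym_eq_choose, Fintype.card_fin]
  rw [show k + 1 + n - 1 = n + k by omega, Nat.choose_symm_add]

/-- The lattice point of `t • reeve m` with residue `-r` of the height modulo `m`, parametrized by
the rounded barycentric coordinates `p`; here `e = 0` if `r = 0`, and `e = 1` otherwise. -/
def reevePoint (m e : ℕ) (q : ℕ × (Fin 4 → ℕ)) : Fin 3 → ℝ :=
  ![((q.2 1 + q.2 3 + e : ℤ) : ℝ), ((q.2 2 + q.2 3 + e : ℤ) : ℝ),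
    ((m * (q.2 3 + e) - q.1 : ℤ) : ℝ)]

lemma intCast_vec_inj {a b c a' b' c' : ℤ} :
    ![(a : ℝ), (b : ℝ), (c : ℝ)] = ![(a' : ℝ), (b' : ℝ), (c' : ℝ)] ↔
      a = a' ∧ b = b' ∧ c = c' := by
  simp [Matrix.vecCons_inj]

lemma reevePoint_injOn (m e s : ℕ) :
    Set.InjOn (reevePoint m e)
      (Finset.range m ×ˢ Finset.Nat.antidiagonalTuple 4 s : Finset (ℕ × (Fin 4 → ℕ))) := by
  rintro ⟨r, p⟩ hp ⟨r', p'⟩ hp' h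
  simp only [Finset.coe_product, Set.mem_prod, Finset.mem_coe, Finset.mem_range,
    Finset.Nat.mem_antidiagonalTuple, Fin.sum_univ_four] at hp hp'
  simp only [reevePoint, intCast_vec_inj] at h
  obtain ⟨h0, h1, h2⟩ := h
  have hq : (p 3 : ℤ) = p' 3 := by
    rcases lt_trichotomy (p 3 : ℤ) (p' 3) with hlt | heq | hgt
    · nlinarith [mul_le_mul_of_nonneg_left (Int.add_one_le_of_lt hlt) (Int.natCast_nonneg m)]
    · exact heq
    · nlinarith [mul_le_mul_of_nonneg_left (Int.add_one_le_of_lt hgt) (Int.natCast_nonneg m)]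
  have hr : r = r' := by
    rw [hq] at h2
    omega
  refine Prod.ext hr (funext fun i => ?_)
  fin_cases i <;> simp <;> omega

lemma latticePoints_reeve {m : ℕ} (hm : 0 < m) {t : ℕ} (ht : 0 < t) :
    latticePoints (reeve m) t =
      {x | ∃ a b c : ℤ, x = ![(a : ℝ), (b : ℝ), (c : ℝ)] ∧
        0 ≤ c ∧ c ≤ m * a ∧ c ≤ m * b ∧ m * (a + b) ≤ m * t + c} := by
  ext x
  simp only [latticePoints, Set.mem_ofPred_eq,
    mem_smul_reeve_iff hm (show (0 : ℝ) < t by exact_mod_cast ht)]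
  constructor
  · rintro ⟨⟨h1, h2, h3, h4⟩, hint⟩
    obtain ⟨a, ha⟩ := hint 0
    obtain ⟨b, hb⟩ := hint 1
    obtain ⟨c, hc⟩ := hint 2
    rw [ha, hc] at h2
    rw [hb, hc] at h3
    rw [ha, hb, hc] at h4
    rw [hc] at h1
    refine ⟨a, b, c, ?_, by exact_mod_cast h1, by exact_mod_cast h2, by exact_mod_cast h3,
      by exact_mod_cast h4⟩
    ext i
    fin_cases i <;> simp [ha, hb, hc]
  · rintro ⟨a, b, c, rfl, h1, h2, h3, h4⟩
    refine ⟨?_, fun i => ?_⟩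
    · simp only [Matrix.cons_val]
      exact ⟨by exact_mod_cast h1, by exact_mod_cast h2, by exact_mod_cast h3,
        by exact_mod_cast h4⟩
    · fin_cases i
      exacts [⟨a, rfl⟩, ⟨b, rfl⟩, ⟨c, rfl⟩]

/-- Index set of the lattice points of `t • reeve m` whose height is not divisible by `m`. -/
def fractionalIndices (m t : ℕ) : Finset (ℕ × (Fin 4 → ℕ)) :=
  if 2 ≤ t then Finset.Ico 1 m ×ˢ Finset.Nat.antidiagonalTuple 4 (t - 2) else ∅

lemma mem_fractionalIndices {m t : ℕ} {q : ℕ × (Fin 4 → ℕ)} :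
    q ∈ fractionalIndices m t ↔
      (1 ≤ q.1 ∧ q.1 < m) ∧ q.2 0 + q.2 1 + q.2 2 + q.2 3 + 2 = t := by
  unfold fractionalIndices
  split_ifs with h
  · simp only [Finset.mem_product, Finset.mem_Ico, Finset.Nat.mem_antidiagonalTuple,
      Fin.sum_univ_four]
    omega
  · simp only [Finset.notMem_empty, false_iff]
    omega

lemma card_fractionalIndices (m t : ℕ) :
    (fractionalIndices m t).card = (m - 1) * (t + 1).choose 3 := by
  unfold fractionalIndices
  split_ifs with h
  · rw [Finset.card_product, card_antidiagonalTuple_succ, Nat.card_Ico,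
      show t - 2 + 3 = t + 1 by omega]
  · rw [Nat.choose_eq_zero_of_lt (by omega)]
    simp

/-- Index set of the lattice points of `t • reeve m` whose height is divisible by `m`. -/
def integralIndices (t : ℕ) : Finset (ℕ × (Fin 4 → ℕ)) :=
  {0} ×ˢ Finset.Nat.antidiagonalTuple 4 t

lemma mem_integralIndices {t : ℕ} {q : ℕ × (Fin 4 → ℕ)} :
    q ∈ integralIndices t ↔ q.1 = 0 ∧ q.2 0 + q.2 1 + q.2 2 + q.2 3 = t := by
  rw [integralIndices, Finset.mem_product, Finset.mem_singleton,
    Finset.Nat.mem_antidiagonalTuple, Fin.sum_univ_four]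

lemma latticePoints_reeve_eq_union {m : ℕ} (hm : 0 < m) {t : ℕ} (ht : 0 < t) :
    latticePoints (reeve m) t =
      reevePoint m 0 '' (integralIndices t) ∪ reevePoint m 1 '' (fractionalIndices m t) := by
  have hm' : (0 : ℤ) < m := by exact_mod_cast hm
  rw [latticePoints_reeve hm ht]
  ext x
  simp only [Set.mem_ofPred_eq, Set.mem_union, Set.mem_image, Finset.mem_coe, mem_integralIndices,
    mem_fractionalIndices]
  constructor
  · rintro ⟨a, b, c, rfl, h1, h2, h3, h4⟩
    have hdiv : m * (c / m) + c % m = c := Int.mul_ediv_add_emod c m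
    have hmod0 : 0 ≤ c % m := Int.emod_nonneg _ hm'.ne'
    have hmod1 : c % m < m := Int.emod_lt_of_pos _ hm'
    have hd0 : 0 ≤ c / m := Int.ediv_nonneg h1 hm'.le
    generalize c / m = d at *
    generalize c % m = r at *
    subst hdiv
    rcases hmod0.eq_or_lt with rfl | hr
    · have ha : d ≤ a := le_of_mul_le_mul_left (by linarith) hm'
      have hb : d ≤ b := le_of_mul_le_mul_left (by linarith) hm'
      have hab : a + b ≤ t + d := le_of_mul_le_mul_left (by linarith) hm'
      refine Or.inl ⟨(0, ![(t + d - a - b).toNat, (a - d).toNat, (b - d).toNat, d.toNat]),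
        ⟨rfl, ?_⟩, ?_⟩
      · simp only [Matrix.cons_val]
        omega
      · simp only [reevePoint, intCast_vec_inj, Matrix.cons_val]
        refine ⟨by omega, by omega, ?_⟩
        rw [Int.toNat_of_nonneg hd0]
        simp
    · have ha : d < a := lt_of_mul_lt_mul_left (by linarith) hm'.le
      have hb : d < b := lt_of_mul_lt_mul_left (by linarith) hm'.le
      have hab : a + b < t + d + 1 := lt_of_mul_lt_mul_left (by linarith) hm'.le
      refine Or.inr ⟨((m - r).toNat,
        ![(t + d - a - b).toNat, (a - d - 1).toNat, (b - d - 1).toNat, d.toNat]),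
        ⟨by dsimp only; omega, ?_⟩, ?_⟩
      · simp only [Matrix.cons_val]
        omega
      · simp only [reevePoint, intCast_vec_inj, Matrix.cons_val]
        refine ⟨by omega, by omega, ?_⟩
        rw [Int.toNat_of_nonneg hd0, Int.toNat_of_nonneg (by linarith)]
        push_cast
        ring
  · rintro (⟨⟨r, p⟩, ⟨hr, hp⟩, rfl⟩ | ⟨⟨r, p⟩, ⟨⟨hr1, hrm⟩, hp⟩, rfl⟩)
    · dsimp only at hr hp
      subst hr
      refine ⟨_, _, _, rfl, ?_, ?_, ?_, ?_⟩ <;> push_cast [← hp]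
      · simp
        positivity
      all_goals nlinarith [mul_nonneg hm'.le (Int.natCast_nonneg (p 0)),
        mul_nonneg hm'.le (Int.natCast_nonneg (p 1)), mul_nonneg hm'.le (Int.natCast_nonneg (p 2))]
    · dsimp only at hr1 hrm hp
      have hr1' : (1 : ℤ) ≤ r := by exact_mod_cast hr1
      have hrm' : (r : ℤ) < m := by exact_mod_cast hrm
      refine ⟨_, _, _, rfl, ?_, ?_, ?_, ?_⟩ <;> push_cast [← hp]
      all_goals nlinarith [mul_nonneg hm'.le (Int.natCast_nonneg (p 0)),
        mul_nonneg hm'.le (Int.natCast_nonneg (p 1)), mul_nonneg hm'.le (Int.natCast_nonneg (p 2)),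
        mul_nonneg hm'.le (Int.natCast_nonneg (p 3))]

lemma latticePoints_reeve_finite {m : ℕ} (hm : 0 < m) (t : ℕ) :
    (latticePoints (reeve m) t).Finite := by
  rcases t.eq_zero_or_pos with rfl | ht
  · simp [latticePoints_zero (reeve_nonempty m)]
  · rw [latticePoints_reeve_eq_union hm ht]
    exact ((Finset.finite_toSet _).image _).union ((Finset.finite_toSet _).image _)

lemma latticeCount_reeve {m : ℕ} (hm : 0 < m) {t : ℕ} (ht : 0 < t) :
    latticeCount (reeve m) t = (t + 3).choose 3 + (m - 1) * (t + 1).choose 3 := by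
  rw [latticeCount_eq_ncard_latticePoints, latticePoints_reeve_eq_union hm ht,
    Set.ncard_union_eq _ ((Finset.finite_toSet _).image _) ((Finset.finite_toSet _).image _),
    Set.InjOn.ncard_image, Set.InjOn.ncard_image, Set.ncard_coe_finset,
    Set.ncard_coe_finset, card_fractionalIndices, integralIndices, Finset.card_product,
    Finset.card_singleton, card_antidiagonalTuple_succ, one_mul]
  · refine (reevePoint_injOn m 1 (t - 2)).mono fun q hq => ?_
    simp only [Finset.mem_coe, mem_fractionalIndices] at hq
    simp only [Finset.mem_coe, Finset.mem_product, Finset.mem_range,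
      Finset.Nat.mem_antidiagonalTuple, Fin.sum_univ_four]
    omega
  · refine (reevePoint_injOn m 0 t).mono fun q hq => ?_
    simp only [Finset.mem_coe, mem_integralIndices] at hq
    simp only [Finset.mem_coe, Finset.mem_product, Finset.mem_range,
      Finset.Nat.mem_antidiagonalTuple, Fin.sum_univ_four]
    omega
  · rw [Set.disjoint_left]
    rintro _ ⟨⟨r, p⟩, hp, rfl⟩ ⟨⟨r', p'⟩, hp', h⟩
    simp only [Finset.mem_coe, mem_integralIndices, mem_fractionalIndices] at hp hp'
    simp only [reevePoint, intCast_vec_inj] at h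
    have hdvd : (m : ℤ) ∣ r' := by
      refine ⟨p' 3 + 1 - p 3, ?_⟩
      have h2 := h.2.2
      rw [hp.1] at h2
      push_cast at h2
      linarith
    exact absurd (Nat.le_of_dvd (by omega) (Int.natCast_dvd_natCast.1 hdvd)) (by omega)

lemma pyrIter_nonempty {n : ℕ} {P : Set (Fin n → ℝ)} (hP : P.Nonempty) (k : ℕ) :
    (pyrIter k P).Nonempty := by
  cases k with
  | zero => exact hP
  | succ k => exact pyr_nonempty _

lemma IsIntegralPolytope.pyrIter {n : ℕ} {P : Set (Fin n → ℝ)} (hP : IsIntegralPolytope P)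
    (k : ℕ) : IsIntegralPolytope (pyrIter k P) := by
  induction k with
  | zero => exact hP
  | succ k ih => exact ih.pyr

lemma affineSpan_pyrIter {n : ℕ} {P : Set (Fin n → ℝ)} (hP : affineSpan ℝ P = ⊤) (k : ℕ) :
    affineSpan ℝ (pyrIter k P) = ⊤ := by
  induction k with
  | zero => exact hP
  | succ k ih => exact affineSpan_pyr ih

lemma latticePoints_pyrIter_finite {n : ℕ} {P : Set (Fin n → ℝ)} (hP : IsIntegralPolytope P)
    (hne : P.Nonempty) (hfin : ∀ t, (latticePoints P t).Finite) (k t : ℕ) :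
    (latticePoints (pyrIter k P) t).Finite := by
  induction k generalizing t with
  | zero => exact hfin t
  | succ k ih => exact latticePoints_pyr_finite (hP.pyrIter k).convex (pyrIter_nonempty hne k) ih t

lemma latticeCount_pyrIter_reeve {m : ℕ} (hm : 0 < m) (k t : ℕ) :
    latticeCount (pyrIter k (reeve m)) t =
      (t + k + 3).choose (k + 3) + (m - 1) * (t + k + 1).choose (k + 3) := by
  have hzero (k : ℕ) : latticeCount (pyrIter k (reeve m)) 0 =
      (0 + k + 3).choose (k + 3) + (m - 1) * (0 + k + 1).choose (k + 3) := by
    rw [latticeCount_eq_ncard_latticePoints,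
      latticePoints_zero (pyrIter_nonempty (reeve_nonempty m) k), Set.ncard_singleton, zero_add,
      Nat.choose_self, Nat.choose_eq_zero_of_lt (by omega), mul_zero, add_zero]
  induction k generalizing t with
  | zero =>
    rcases t.eq_zero_or_pos with rfl | ht
    · exact hzero 0
    · exact latticeCount_reeve hm ht
  | succ k ihk =>
    induction t with
    | zero => exact hzero (k + 1)
    | succ t iht =>
      have hint := isIntegralPolytope_reeve m
      have hrec := latticeCount_pyr_succ (hint.pyrIter k).convex
        (pyrIter_nonempty (reeve_nonempty m) k)
        (latticePoints_pyrIter_finite hint (reeve_nonempty m) (latticePoints_reeve_finite hm) k) t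
      have h3 := Nat.choose_succ_succ (t + 1 + k + 3) (k + 3)
      have h1 := Nat.choose_succ_succ (t + 1 + k + 1) (k + 3)
      rw [show t + 1 + k + 3 = t + (k + 1) + 3 by omega] at h3
      rw [show t + 1 + k + 1 = t + (k + 1) + 1 by omega] at h1
      rw [ihk, show t + 1 + k + 3 = t + (k + 1) + 3 by omega,
        show t + 1 + k + 1 = t + (k + 1) + 1 by omega] at hrec
      rw [show t + 1 + (k + 1) + 3 = (t + (k + 1) + 3).succ by omega,
        show t + 1 + (k + 1) + 1 = (t + (k + 1) + 1).succ by omega,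
        show k + 1 + 3 = (k + 3).succ by omega, h3, h1]
      refine hrec.trans ?_
      rw [show pyr (pyrIter k (reeve m)) = pyrIter (k + 1) (reeve m) from rfl, iht,
        show k + 1 + 3 = (k + 3).succ by omega]
      ring

/-- `Pyr^k(T_m)` is a full-dimensional integral polytope of dimension `k+3`, and
`i(Pyr^k(T_m), t) = C(t+k+3, k+3) + (m−1)·C(t+k+1, k+3)`. -/
theorem pyrIter_reeve_latticeCount (m k : ℕ) (hm : 0 < m) :
    IsIntegralPolytope (pyrIter k (reeve m)) ∧
    affineSpan ℝ (pyrIter k (reeve m)) = ⊤ ∧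
    ∀ t : ℕ, 0 < t →
      latticeCount (pyrIter k (reeve m)) t =
        Nat.choose (t + k + 3) (k + 3) + (m - 1) * Nat.choose (t + k + 1) (k + 3) := by
  exact ⟨(isIntegralPolytope_reeve m).pyrIter k, affineSpan_pyrIter (affineSpan_reeve hm) k,
    fun t _ => latticeCount_pyrIter_reeve hm k t⟩
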